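/- Let R be a λ-ring with an augmentation ε : R → ℤ which is a ring homomorphism commuting with the λ-operations, let F^m R denote the γ-filtration, and let ψ^k denote the k-th Adams operation. Then for every n ≥ 0, every k ≥ 1 and every x ∈ F^n R, one has ψ^k(x) − k^n·x ∈ F^{n+1} R; equivalently, ψ^k acts on the graded piece F^n R / F^{n+1} R as multiplication by k^n. -/

import Mathlib

open Finset MvPolynomial

/-- The `n`-th elementary symmetric function of the family `f` restricted to the finite set `s`. -/
noncomputable def esymmAt {ι A : Type*} [CommRing A] (s : Finset ι) (n : ℕ) (f : ι → A) : A :=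
  ∑ t ∈ s.powersetCard n, ∏ i ∈ t, f i

/-- `IsPk k P` says that `P` is the universal integer polynomial in `2k` variables with
`P(e_1(x),…,e_k(x); e_1(y),…,e_k(y))` equal to the `k`-th elementary symmetric polynomial of
the `k²` products `x_i·y_j`. -/
def IsPk (k : ℕ) (P : MvPolynomial (Fin k ⊕ Fin k) ℤ) : Prop :=
  aeval (Sum.elim
      (fun i : Fin k => esymmAt Finset.univ (i.1 + 1)
        (fun j : Fin k => (X (Sum.inl j) : MvPolynomial (Fin k ⊕ Fin k) ℤ)))
      (fun i : Fin k => esymmAt Finset.univ (i.1 + 1)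
        (fun j : Fin k => (X (Sum.inr j) : MvPolynomial (Fin k ⊕ Fin k) ℤ)))) P
    = esymmAt Finset.univ k
      (fun p : Fin k × Fin k =>
        (X (Sum.inl p.1) : MvPolynomial (Fin k ⊕ Fin k) ℤ) * X (Sum.inr p.2))

/-- `IsPkl k m Q` says that `Q` is the universal integer polynomial in `k·m` variables with
`Q(e_1(x),…,e_{km}(x))` equal to the `k`-th elementary symmetric polynomial of the products
`x_{i_1}⋯x_{i_m}` over all `m`-element subsets of `{1,…,km}`. -/
def IsPkl (k m : ℕ) (Q : MvPolynomial (Fin (k * m)) ℤ) : Prop :=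
  aeval (fun i : Fin (k * m) => esymmAt Finset.univ (i.1 + 1)
      (fun j : Fin (k * m) => (X j : MvPolynomial (Fin (k * m)) ℤ))) Q
    = esymmAt (Finset.univ.powersetCard m) k
      (fun t : Finset (Fin (k * m)) => ∏ i ∈ t, (X i : MvPolynomial (Fin (k * m)) ℤ))

/-- A λ-ring structure (in the sense of Grothendieck, i.e. a "special" λ-ring) on the
commutative ring `R`, given by operations `l n : R → R`. -/
structure IsLambdaRing {R : Type*} [CommRing R] (l : ℕ → R → R) : Prop where
  map_zero : ∀ r, l 0 r = 1
  map_one : ∀ r, l 1 r = r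
  add_eq : ∀ (n : ℕ) (r s : R), l n (r + s) = ∑ i ∈ Finset.range (n + 1), l i r * l (n - i) s
  one_eq : ∀ n, 1 < n → l n (1 : R) = 0
  mul_eq : ∀ k, 1 ≤ k → ∀ P : MvPolynomial (Fin k ⊕ Fin k) ℤ, IsPk k P →
    ∀ r s : R, l k (r * s) =
      aeval (Sum.elim (fun i : Fin k => l (i.1 + 1) r) (fun j : Fin k => l (j.1 + 1) s)) P
  comp_eq : ∀ k m, 1 ≤ k → 1 ≤ m → ∀ Q : MvPolynomial (Fin (k * m)) ℤ, IsPkl k m Q →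
    ∀ r : R, l k (l m r) = aeval (fun i : Fin (k * m) => l (i.1 + 1) r) Q

/-- The γ-operations of a (pre-)λ-ring: `γ^n(x) = λ^n(x + (n-1)·1)` (note that for `n = 0`
this gives `γ^0(x) = λ^0(x) = 1`). -/
noncomputable def gammaOp {R : Type*} [CommRing R] (l : ℕ → R → R) (n : ℕ) (x : R) : R :=
  l n (x + ((n - 1 : ℕ) : R))

/-- The γ-filtration of an augmented λ-ring: `F^0 R = R`, and for `m ≥ 1`, `F^m R` is the
additive subgroup generated by the products `γ^{i_1}(x_1)⋯γ^{i_p}(x_p)` with `p ≥ 1`,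
`i_j ≥ 1`, `x_j ∈ ker ε` and `i_1 + ⋯ + i_p ≥ m`. -/
noncomputable def gammaFil {R : Type*} [CommRing R] (l : ℕ → R → R) (ε : R →+* ℤ) :
    ℕ → AddSubgroup R
  | 0 => ⊤
  | m + 1 => AddSubgroup.closure
      {x : R | ∃ (p : ℕ) (is : Fin (p + 1) → ℕ) (a : Fin (p + 1) → R),
        (∀ j, 1 ≤ is j) ∧ (∀ j, ε (a j) = 0) ∧ (m + 1 ≤ ∑ j, is j) ∧
        x = ∏ j, gammaOp l (is j) (a j)}

section Esymm

variable {ι κ A B : Type*} [CommRing A] [CommRing B]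

lemma esymmAt_zero (s : Finset ι) (f : ι → A) : esymmAt s 0 f = 1 := by
  simp [esymmAt]

lemma map_esymmAt (φ : A →+* B) (s : Finset ι) (n : ℕ) (f : ι → A) :
    φ (esymmAt s n f) = esymmAt s n (fun i => φ (f i)) := by
  simp [esymmAt, map_sum, map_prod]

lemma esymmAt_congr {s : Finset ι} {f g : ι → A} (h : ∀ i ∈ s, f i = g i) (n : ℕ) :
    esymmAt s n f = esymmAt s n g := by
  unfold esymmAt
  refine Finset.sum_congr rfl fun t ht => Finset.prod_congr rfl fun i hi => h i ?_
  exact (Finset.mem_powersetCard.1 ht).1 hi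

lemma esymmAt_smul (s : Finset ι) (n : ℕ) (c : A) (f : ι → A) :
    esymmAt s n (fun i => c * f i) = c ^ n * esymmAt s n f := by
  unfold esymmAt
  rw [Finset.mul_sum]
  refine Finset.sum_congr rfl fun t ht => ?_
  rw [Finset.prod_mul_distrib, Finset.prod_const, (Finset.mem_powersetCard.1 ht).2]

lemma coeff_prod_one_add_C_mul_X (s : Finset ι) (f : ι → A) (n : ℕ) :
    (∏ i ∈ s, (1 + Polynomial.C (f i) * Polynomial.X)).coeff n = esymmAt s n f := by
  classical
  rw [Finset.prod_one_add, Polynomial.finsetSum_coeff]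
  have h : ∀ t ∈ s.powerset, (∏ i ∈ t, (Polynomial.C (f i) * Polynomial.X : Polynomial A)).coeff n
      = if t.card = n then ∏ i ∈ t, f i else 0 := by
    intro t _
    rw [Finset.prod_mul_distrib, Finset.prod_const, ← map_prod, Polynomial.coeff_C_mul_X_pow]
    simp [eq_comm]
  rw [Finset.sum_congr rfl h, ← Finset.sum_filter, esymmAt, Finset.powersetCard_eq_filter]

lemma esymmAt_of_subset {s t : Finset ι} (hst : s ⊆ t) {f : ι → A}
    (h : ∀ i ∈ t, i ∉ s → f i = 0) (n : ℕ) : esymmAt t n f = esymmAt s n f := by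
  rw [← coeff_prod_one_add_C_mul_X, ← coeff_prod_one_add_C_mul_X]
  congr 1
  symm
  refine Finset.prod_subset hst fun i hi his => ?_
  simp [h i hi his]

lemma esymmAt_map (e : ι ↪ κ) (s : Finset ι) (f : κ → A) (n : ℕ) :
    esymmAt (s.map e) n f = esymmAt s n (fun i => f (e i)) := by
  rw [← coeff_prod_one_add_C_mul_X, ← coeff_prod_one_add_C_mul_X, Finset.prod_map]

lemma esymmAt_sumElim [Fintype ι] [Fintype κ] (x : ι → A) (y : κ → A) (n : ℕ) :
    esymmAt Finset.univ n (Sum.elim x y) =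
      ∑ i ∈ Finset.range (n + 1), esymmAt Finset.univ i x * esymmAt Finset.univ (n - i) y := by
  simp only [← coeff_prod_one_add_C_mul_X]
  rw [Fintype.prod_sum_type, Polynomial.coeff_mul, Finset.Nat.sum_antidiagonal_eq_sum_range_succ_mk]
  simp

lemma aeval_esymm_eq_esymmAt [Fintype ι] [Algebra A B] (x : ι → B) (n : ℕ) :
    aeval x (esymm ι A n) = esymmAt Finset.univ n x := by
  simp [esymm, esymmAt, map_sum, map_prod]

lemma coeff_prod_congr (s : Finset ι) (d : ℕ) (P Q : ι → Polynomial A)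
    (h : ∀ i ∈ s, ∀ j ≤ d, (P i).coeff j = (Q i).coeff j) :
    ∀ j ≤ d, (∏ i ∈ s, P i).coeff j = (∏ i ∈ s, Q i).coeff j := by
  classical
  induction s using Finset.induction_on with
  | empty => simp
  | insert a s ha ih =>
    intro j hj
    rw [Finset.prod_insert ha, Finset.prod_insert ha, Polynomial.coeff_mul, Polynomial.coeff_mul]
    refine Finset.sum_congr rfl fun p hp => ?_
    rw [Finset.HasAntidiagonal.mem_antidiagonal] at hp
    rw [h a (Finset.mem_insert_self _ _) _ (by omega),
      ih (fun i hi => h i (Finset.mem_insert_of_mem hi)) _ (by omega)]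

lemma esymmAt_prod_eq_coeff [Fintype ι] [Fintype κ] (x : ι → A) (y : κ → A) (n : ℕ) :
    esymmAt Finset.univ n (fun p : ι × κ => x p.1 * y p.2) =
      (∏ i : ι, ∏ j : κ, (1 + Polynomial.C (x i * y j) * Polynomial.X)).coeff n := by
  rw [← coeff_prod_one_add_C_mul_X, Fintype.prod_prod_type]

lemma esymmAt_mul_congr_right [Fintype ι] [Fintype κ] {κ' : Type*} [Fintype κ'] (x : ι → A)
    (y : κ → A) (y' : κ' → A) (n : ℕ)
    (h : ∀ j ≤ n, esymmAt Finset.univ j y = esymmAt Finset.univ j y') :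
    esymmAt Finset.univ n (fun p : ι × κ => x p.1 * y p.2) =
      esymmAt Finset.univ n (fun p : ι × κ' => x p.1 * y' p.2) := by
  rw [esymmAt_prod_eq_coeff, esymmAt_prod_eq_coeff]
  refine coeff_prod_congr _ n _ _ (fun i _ j hj => ?_) n le_rfl
  rw [coeff_prod_one_add_C_mul_X, coeff_prod_one_add_C_mul_X, esymmAt_smul, esymmAt_smul, h j hj]

lemma esymmAt_mul_comm [Fintype ι] [Fintype κ] (x : ι → A) (y : κ → A) (n : ℕ) :
    esymmAt Finset.univ n (fun p : ι × κ => x p.1 * y p.2) =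
      esymmAt Finset.univ n (fun p : κ × ι => y p.1 * x p.2) := by
  have := esymmAt_map (Equiv.prodComm κ ι).toEmbedding Finset.univ
    (fun p : ι × κ => x p.1 * y p.2) n
  rw [Finset.map_univ_equiv] at this
  simpa [mul_comm] using this

lemma esymmAt_mul_congr [Fintype ι] [Fintype κ] {ι' κ' : Type*} [Fintype ι'] [Fintype κ']
    (x : ι → A) (x' : ι' → A) (y : κ → A) (y' : κ' → A) (n : ℕ)
    (hx : ∀ j ≤ n, esymmAt Finset.univ j x = esymmAt Finset.univ j x')
    (hy : ∀ j ≤ n, esymmAt Finset.univ j y = esymmAt Finset.univ j y') :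
    esymmAt Finset.univ n (fun p : ι × κ => x p.1 * y p.2) =
      esymmAt Finset.univ n (fun p : ι' × κ' => x' p.1 * y' p.2) := by
  rw [esymmAt_mul_congr_right x y y' n hy, esymmAt_mul_comm, esymmAt_mul_congr_right y' x x' n hx,
    esymmAt_mul_comm]

/-- Newton's identity for the power sums of a finite family. -/
lemma sum_pow_eq_newton (s : Finset ι) (f : ι → A) {k : ℕ} (hk : 0 < k) :
    ∑ i ∈ s, f i ^ k =
      (∑ i ∈ Finset.Ico 1 k, (-1 : A) ^ (i + 1) * (esymmAt s i f * ∑ a ∈ s, f a ^ (k - i))) +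
        (-1 : A) ^ (k + 1) * (k : A) * esymmAt s k f := by
  classical
  have hs : ∀ j, aeval (fun i : s => f i) (esymm s A j) = esymmAt s j f := by
    intro j
    rw [aeval_esymm_eq_esymmAt]
    have := esymmAt_map (Function.Embedding.subtype (· ∈ s)) Finset.univ f j
    refine this.symm.trans ?_
    congr 1
    ext i; simp
  have hp : ∀ j, aeval (fun i : s => f i) (psum s A j) = ∑ i ∈ s, f i ^ j := by
    intro j
    simp only [psum, map_sum, map_pow, aeval_X]
    exact Finset.sum_coe_sort s (fun i => f i ^ j)
  have := congrArg (aeval (fun i : s => f i)) (psum_eq_mul_esymm_sub_sum s A k hk)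
  rw [hp] at this
  rw [this]
  simp only [map_sub, map_mul, map_pow, map_neg, map_one, map_natCast, map_sum, hs, hp]
  rw [sub_eq_add_neg, add_comm, ← Finset.sum_neg_distrib, Finset.sum_filter,
    Finset.Nat.sum_antidiagonal_eq_sum_range_succ_mk, ← Finset.sum_filter]
  congr 1
  refine Finset.sum_congr ?_ fun i hi => by ring
  ext i
  simp only [Finset.mem_filter, Finset.mem_range, Set.mem_Ioo, Finset.mem_Ico]
  omega

/-- The elementary symmetric functions of the shifted family `f - 1`. -/
lemma esymmAt_sub_one (s : Finset ι) (f : ι → A) {n : ℕ} (hn : n ≤ s.card) :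
    esymmAt s n (fun i => f i - 1) =
      ∑ i ∈ Finset.range (n + 1),
        (((-1) ^ (n - i) * ((s.card - i).choose (n - i) : ℤ) : ℤ) : A) * esymmAt s i f := by
  classical
  have h1 : ∏ i ∈ s, (1 + Polynomial.C (f i - 1) * Polynomial.X : Polynomial A) =
      ∏ i ∈ s, (Polynomial.C (f i) * Polynomial.X + (1 - Polynomial.X)) :=
    Finset.prod_congr rfl fun i _ => by simp; ring
  rw [← coeff_prod_one_add_C_mul_X, h1, Finset.prod_add, Finset.sum_powerset,
    Polynomial.finsetSum_coeff]
  have hc : ∀ (N m : ℕ), ((1 - Polynomial.X : Polynomial A) ^ N).coeff m =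
      (((-1) ^ m * (N.choose m : ℤ) : ℤ) : A) := by
    intro N m
    have : (1 - Polynomial.X : Polynomial A) ^ N =
        ((1 + Polynomial.X) ^ N).comp (Polynomial.C (-1) * Polynomial.X) := by
      simp [sub_eq_add_neg]
    rw [this, Polynomial.comp_C_mul_X_coeff, Polynomial.coeff_one_add_X_pow]
    simp [mul_comm]
  have h2 : ∀ j ∈ Finset.range (s.card + 1),
      (∑ t ∈ s.powersetCard j, (∏ i ∈ t, (Polynomial.C (f i) * Polynomial.X)) *
        ∏ i ∈ s \ t, (1 - Polynomial.X : Polynomial A)).coeff n =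
      if j ≤ n then (((-1) ^ (n - j) * ((s.card - j).choose (n - j) : ℤ) : ℤ) : A) * esymmAt s j f
        else 0 := by
    intro j _
    rw [Polynomial.finsetSum_coeff, esymmAt]
    split_ifs with hj
    · rw [Finset.mul_sum]
      refine Finset.sum_congr rfl fun t ht => ?_
      obtain ⟨hts, htc⟩ := Finset.mem_powersetCard.1 ht
      rw [Finset.prod_mul_distrib, Finset.prod_const, Finset.prod_const, ← map_prod, mul_assoc,
        Polynomial.coeff_C_mul, mul_comm (Polynomial.X ^ _), htc, Polynomial.coeff_mul_X_pow',
        if_pos hj, hc, Finset.card_sdiff_of_subset hts, htc, mul_comm]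
    · refine Finset.sum_eq_zero fun t ht => ?_
      obtain ⟨hts, htc⟩ := Finset.mem_powersetCard.1 ht
      rw [Finset.prod_mul_distrib, Finset.prod_const, Finset.prod_const, ← map_prod, mul_assoc,
        Polynomial.coeff_C_mul, mul_comm (Polynomial.X ^ _), htc, Polynomial.coeff_mul_X_pow',
        if_neg hj, mul_zero]
  rw [Finset.sum_congr rfl h2, ← Finset.sum_filter]
  refine Finset.sum_congr ?_ fun _ _ => rfl
  ext j
  simp only [Finset.mem_filter, Finset.mem_range]
  omega

end Esymm

section Universal

/-- A sequence with `c 0 = 1` is, up to degree `n`, the sequence of elementary symmetric functions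
of `n` elements of some ring extension. -/
lemma exists_esymmAt_eq.{u} {A : Type u} [CommRing A] [Nontrivial A] (n : ℕ) (c : ℕ → A)
    (hc : c 0 = 1) :
    ∃ (B : Type u) (_ : CommRing B) (_ : Nontrivial B) (φ : A →+* B) (x : Fin n → B),
      Function.Injective φ ∧ ∀ j ≤ n, φ (c j) = esymmAt Finset.univ j x := by
  classical
  set p : Polynomial A :=
    ∑ j ∈ Finset.range (n + 1), Polynomial.C (c (n - j)) * Polynomial.X ^ j with hp
  have hcoeff : ∀ j ≤ n, p.coeff j = c (n - j) := by
    intro j hj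
    simp only [hp, Polynomial.finsetSum_coeff, Polynomial.coeff_C_mul_X_pow]
    rw [Finset.sum_ite_eq, if_pos (Finset.mem_range.2 (by omega))]
  have hdeg : p.natDegree ≤ n :=
    Polynomial.natDegree_sum_le_of_forall_le _ _ fun j hj =>
      (Polynomial.natDegree_C_mul_X_pow_le _ _).trans (by simp at hj; omega)
  have hmonic : p.Monic := Polynomial.monic_of_natDegree_le_of_coeff_eq_one n hdeg
    (by rw [hcoeff n le_rfl, Nat.sub_self, hc])
  have hdeg' : p.natDegree = n := le_antisymm hdeg
    (Polynomial.le_natDegree_of_ne_zero (by rw [hcoeff n le_rfl, Nat.sub_self, hc]; simp))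
  obtain ⟨B, _, _, _, _, _, hB⟩ := hmonic.exists_splits_map
  obtain ⟨m, hm⟩ := Polynomial.splits_iff_exists_multiset'.1 hB
  rw [(hmonic.map _).leadingCoeff, map_one, one_mul] at hm
  have hcard : m.card = n := by
    have h1 := congrArg Polynomial.natDegree hm
    rw [hmonic.natDegree_map, hdeg', Polynomial.natDegree_multiset_prod_of_monic] at h1
    · simpa using h1.symm
    · intro q hq
      obtain ⟨a, -, rfl⟩ := Multiset.mem_map.1 hq
      exact Polynomial.monic_X_add_C a
  obtain ⟨x, hx⟩ : ∃ x : Fin n → B, Finset.univ.val.map x = m := by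
    subst hcard
    refine ⟨fun i => m.toList.get (i.cast (by simp)), ?_⟩
    rw [Fin.univ_val_map]
    conv_rhs => rw [← Multiset.coe_toList m]
    congr 1
    apply List.ext_get <;> simp
  refine ⟨B, inferInstance, inferInstance, algebraMap A B, x,
    FaithfulSMul.algebraMap_injective A B, fun j hj => ?_⟩
  have h2 := congrArg (fun q => Polynomial.coeff q (n - j)) hm
  simp only [Polynomial.coeff_map] at h2
  rw [hcoeff _ (Nat.sub_le _ _), Nat.sub_sub_self hj,
    Multiset.prod_X_add_C_coeff _ (by rw [hcard]; omega), hcard, Nat.sub_sub_self hj] at h2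
  rw [h2, ← hx, Finset.esymm_map_val]
  rfl

lemma exists_aeval_esymmAt_of_isSymmetric {A : Type*} [CommRing A] {n : ℕ}
    {f : MvPolynomial (Fin n) A} (hf : f.IsSymmetric) :
    ∃ Q : MvPolynomial (Fin n) A,
      aeval (fun i : Fin n => esymmAt Finset.univ (i.1 + 1) (X : Fin n → MvPolynomial _ A)) Q =
        f := by
  obtain ⟨Q, hQ⟩ := esymmAlgHom_surjective (σ := Fin n) A (n := n) (by simp) ⟨f, hf⟩
  refine ⟨Q, ?_⟩
  have h := congrArg Subtype.val hQ
  rw [esymmAlgHom_apply] at h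
  exact h

lemma aeval_esymmAt_of_eq {A B : Type*} [CommRing A] [CommRing B] [Algebra A B] {n : ℕ}
    {Q f : MvPolynomial (Fin n) A}
    (h : aeval (fun i : Fin n => esymmAt Finset.univ (i.1 + 1) (X : Fin n → MvPolynomial _ A)) Q =
      f) (x : Fin n → B) :
    aeval (fun i : Fin n => esymmAt Finset.univ (i.1 + 1) x) Q = aeval x f := by
  rw [← h, ← AlgHom.comp_apply, comp_aeval]
  congr 2
  funext i
  have := map_esymmAt (aeval (R := A) x).toRingHom Finset.univ (i.1 + 1) X
  simpa using this.symm

/-- The polynomials `P_k` exist. -/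
lemma exists_isPk (k : ℕ) : ∃ P, IsPk k P := by
  set q : Fin k → Polynomial (MvPolynomial (Fin k) (MvPolynomial (Fin k) ℤ)) := fun i =>
    1 + ∑ j : Fin k, Polynomial.C (C (X j) * X i ^ (j.1 + 1)) * Polynomial.X ^ (j.1 + 1) with hq
  have hsymm : ((∏ i, q i).coeff k).IsSymmetric := by
    intro e
    have h : ∀ i, (q i).map (rename e : _ →ₐ[MvPolynomial (Fin k) ℤ] _).toRingHom = q (e i) := by
      intro i
      simp [hq, Polynomial.map_sum]
    have h2 := congrArg (fun p => Polynomial.coeff p k) (Polynomial.map_prod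
      (rename e : _ →ₐ[MvPolynomial (Fin k) ℤ] _).toRingHom q Finset.univ)
    simp only [h, Polynomial.coeff_map] at h2
    rw [Equiv.prod_comp e q] at h2
    exact h2
  obtain ⟨Q, hQ⟩ := esymmAlgHom_surjective (σ := Fin k) (MvPolynomial (Fin k) ℤ) (n := k)
    (by simp) ⟨_, hsymm⟩
  have hQ' : aeval (fun i : Fin k => esymm (Fin k) (MvPolynomial (Fin k) ℤ) (i.1 + 1)) Q =
      (∏ i, q i).coeff k := by
    rw [← esymmAlgHom_apply, hQ]
  refine ⟨(sumAlgEquiv ℤ (Fin k) (Fin k)).symm Q, ?_⟩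
  unfold IsPk
  set φ : MvPolynomial (Fin k) ℤ →+* MvPolynomial (Fin k ⊕ Fin k) ℤ :=
    (aeval (fun i : Fin k => esymmAt Finset.univ (i.1 + 1)
      (fun j : Fin k => (X (Sum.inr j) : MvPolynomial (Fin k ⊕ Fin k) ℤ)))).toRingHom with hφ
  have hsplit : ∀ Q : MvPolynomial (Fin k) (MvPolynomial (Fin k) ℤ),
      aeval (Sum.elim
      (fun i : Fin k => esymmAt Finset.univ (i.1 + 1)
        (fun j : Fin k => (X (Sum.inl j) : MvPolynomial (Fin k ⊕ Fin k) ℤ)))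
      (fun i : Fin k => esymmAt Finset.univ (i.1 + 1)
        (fun j : Fin k => (X (Sum.inr j) : MvPolynomial (Fin k ⊕ Fin k) ℤ))))
        ((sumAlgEquiv ℤ (Fin k) (Fin k)).symm Q) =
      eval₂Hom φ (fun i : Fin k => esymmAt Finset.univ (i.1 + 1)
        (fun j : Fin k => (X (Sum.inl j) : MvPolynomial (Fin k ⊕ Fin k) ℤ))) Q := by
    intro Q
    obtain ⟨Q, rfl⟩ := (sumAlgEquiv ℤ (Fin k) (Fin k)).surjective Q
    rw [AlgEquiv.symm_apply_apply]
    induction Q using MvPolynomial.induction_on with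
    | C a => simp
    | add p q hp hq => simp only [map_add, hp, hq]
    | mul_X p i hp =>
      simp only [map_mul, hp]
      congr 1
      rcases i with i | i <;> simp [hφ]
  rw [hsplit]
  have hev : eval₂Hom φ (fun i : Fin k => esymmAt Finset.univ (i.1 + 1)
        (fun j : Fin k => (X (Sum.inl j) : MvPolynomial (Fin k ⊕ Fin k) ℤ))) Q =
      eval₂Hom φ (fun j : Fin k => (X (Sum.inl j) : MvPolynomial (Fin k ⊕ Fin k) ℤ))
        ((∏ i, q i).coeff k) := by
    rw [← hQ']
    let _ : Algebra (MvPolynomial (Fin k) ℤ) (MvPolynomial (Fin k ⊕ Fin k) ℤ) := φ.toAlgebra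
    change aeval _ Q = aeval _ _
    rw [← AlgHom.comp_apply, comp_aeval]
    simp [aeval_esymm_eq_esymmAt]
  rw [hev, ← Polynomial.coeff_map, Polynomial.map_prod,
    esymmAt_prod_eq_coeff (fun i => X (Sum.inl i)) (fun j => X (Sum.inr j))]
  refine coeff_prod_congr _ k _ _ (fun i _ j hj => ?_) k le_rfl
  rw [coeff_prod_one_add_C_mul_X, esymmAt_smul]
  simp only [hq, Polynomial.map_add, Polynomial.map_one, Polynomial.map_sum, Polynomial.map_mul,
    Polynomial.map_C, Polynomial.map_pow, Polynomial.map_X, map_mul, map_pow, eval₂Hom_X',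
    Polynomial.coeff_add, Polynomial.finsetSum_coeff, coe_eval₂Hom, eval₂_C]
  rcases j with _ | j
  · simp [esymmAt_zero, Polynomial.coeff_X_pow]
  · rw [Finset.sum_eq_single (⟨j, by omega⟩ : Fin k)]
    · rw [← Polynomial.C_pow, ← Polynomial.C_mul, Polynomial.coeff_C_mul_X_pow, if_pos rfl,
        Polynomial.coeff_one]
      simp [hφ, mul_comm]
    · intro b _ hb
      rw [← Polynomial.C_pow, ← Polynomial.C_mul, Polynomial.coeff_C_mul_X_pow, if_neg]
      intro h
      exact hb (Fin.ext (by simpa using h.symm))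
    · simp

/-- The `k`-th elementary symmetric function of the products of the `m`-element subfamilies. -/
noncomputable def esymmSubsetProd {A : Type*} [CommRing A] {ι : Type*} (s : Finset ι) (k m : ℕ)
    (x : ι → A) : A :=
  esymmAt (s.powersetCard m) k (fun t => ∏ i ∈ t, x i)

lemma map_esymmSubsetProd {A B : Type*} [CommRing A] [CommRing B] (φ : A →+* B) {ι : Type*}
    (s : Finset ι) (k m : ℕ) (x : ι → A) :
    φ (esymmSubsetProd s k m x) = esymmSubsetProd s k m (fun i => φ (x i)) := by
  simp [esymmSubsetProd, map_esymmAt, map_prod]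

lemma esymmSubsetProd_smul {A : Type*} [CommRing A] {ι : Type*} (s : Finset ι) (k m : ℕ) (c : A)
    (x : ι → A) :
    esymmSubsetProd s k m (fun i => c * x i) = c ^ (k * m) * esymmSubsetProd s k m x := by
  rw [mul_comm k m, pow_mul, esymmSubsetProd, esymmSubsetProd, ← esymmAt_smul]
  refine esymmAt_congr (fun t ht => ?_) k
  rw [Finset.prod_mul_distrib, Finset.prod_const, (Finset.mem_powersetCard.1 ht).2]

lemma esymmSubsetProd_map {A : Type*} [CommRing A] {ι κ : Type*} (e : ι ↪ κ) (s : Finset ι)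
    (k m : ℕ) (x : κ → A) :
    esymmSubsetProd (s.map e) k m x = esymmSubsetProd s k m (fun i => x (e i)) := by
  rw [esymmSubsetProd, Finset.powersetCard_map, esymmAt_map]
  simp [esymmSubsetProd]

lemma esymmSubsetProd_of_subset {A : Type*} [CommRing A] {ι : Type*} {s t : Finset ι}
    (hst : s ⊆ t) {x : ι → A} (h : ∀ i ∈ t, i ∉ s → x i = 0) (k m : ℕ) :
    esymmSubsetProd t k m x = esymmSubsetProd s k m x := by
  refine esymmAt_of_subset (Finset.powersetCard_mono hst) (fun u hu hus => ?_) k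
  obtain ⟨hut, huc⟩ := Finset.mem_powersetCard.1 hu
  obtain ⟨i, hiu, his⟩ : ∃ i ∈ u, i ∉ s := by
    by_contra! hcon
    exact hus (Finset.mem_powersetCard.2 ⟨hcon, huc⟩)
  exact Finset.prod_eq_zero hiu (h i (hut hiu) his)

lemma exists_aeval_esymmAt_eq_esymmSubsetProd (N k m : ℕ) :
    ∃ Q : MvPolynomial (Fin N) ℤ,
      aeval (fun i : Fin N => esymmAt Finset.univ (i.1 + 1) (X : Fin N → MvPolynomial _ ℤ)) Q =
        esymmSubsetProd Finset.univ k m X := by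
  apply exists_aeval_esymmAt_of_isSymmetric
  intro e
  have h1 := map_esymmSubsetProd (rename e : MvPolynomial (Fin N) ℤ →ₐ[ℤ] _).toRingHom
    Finset.univ k m X
  have h2 := esymmSubsetProd_map e.toEmbedding Finset.univ k m
    (X : Fin N → MvPolynomial (Fin N) ℤ)
  rw [Finset.map_univ_equiv] at h2
  refine Eq.trans ?_ h2.symm
  simpa using h1

lemma aeval_esymmAt_eq_esymmSubsetProd {N k m : ℕ} {Q : MvPolynomial (Fin N) ℤ}
    (hQ : aeval (fun i : Fin N => esymmAt Finset.univ (i.1 + 1) (X : Fin N → MvPolynomial _ ℤ)) Q =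
      esymmSubsetProd Finset.univ k m X) {B : Type*} [CommRing B] (x : Fin N → B) :
    aeval (fun i : Fin N => esymmAt Finset.univ (i.1 + 1) x) Q =
      esymmSubsetProd Finset.univ k m x := by
  rw [aeval_esymmAt_of_eq hQ]
  have := map_esymmSubsetProd (aeval x : MvPolynomial (Fin N) ℤ →ₐ[ℤ] B).toRingHom
    Finset.univ k m X
  simpa using this

lemma esymmSubsetProd_congr {A : Type*} [CommRing A] {N k m : ℕ} {x y : Fin N → A}
    (h : ∀ j ≤ k * m, esymmAt Finset.univ j x = esymmAt Finset.univ j y) :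
    esymmSubsetProd Finset.univ k m x = esymmSubsetProd Finset.univ k m y := by
  obtain ⟨Q, hQ⟩ := exists_aeval_esymmAt_eq_esymmSubsetProd N k m
  set I : Ideal (Polynomial A) := Ideal.span {Polynomial.X ^ (k * m + 1)}
  set π := Ideal.Quotient.mk I
  have key : π (esymmSubsetProd Finset.univ k m (fun i => Polynomial.X * Polynomial.C (x i))) =
      π (esymmSubsetProd Finset.univ k m (fun i => Polynomial.X * Polynomial.C (y i))) := by
    rw [map_esymmSubsetProd, map_esymmSubsetProd, ← aeval_esymmAt_eq_esymmSubsetProd hQ,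
      ← aeval_esymmAt_eq_esymmSubsetProd hQ]
    congr 2
    funext i
    rw [← map_esymmAt, ← map_esymmAt, esymmAt_smul, esymmAt_smul, ← map_esymmAt, ← map_esymmAt]
    by_cases hi : i.1 + 1 ≤ k * m
    · rw [h _ hi]
    · have h0 : π (Polynomial.X ^ (i.1 + 1)) = 0 :=
        Ideal.Quotient.eq_zero_iff_mem.2 (Ideal.mem_span_singleton.2
          (pow_dvd_pow _ (by omega)))
      rw [map_mul, map_mul, h0, zero_mul, zero_mul]
  rw [esymmSubsetProd_smul, esymmSubsetProd_smul, ← map_esymmSubsetProd, ← map_esymmSubsetProd,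
    Ideal.Quotient.eq, Ideal.mem_span_singleton, Polynomial.X_pow_dvd_iff] at key
  have := key (k * m) (by omega)
  simpa [sub_eq_zero, Polynomial.coeff_X_pow_mul', mul_comm (Polynomial.X ^ _)] using this

lemma esymmSubsetProd_congr_of_le {A : Type*} [CommRing A] {n N k m : ℕ} (hn : n ≤ N)
    {x : Fin N → A} {y : Fin n → A}
    (h : ∀ j ≤ k * m, esymmAt Finset.univ j x = esymmAt Finset.univ j y) :
    esymmSubsetProd Finset.univ k m x = esymmSubsetProd Finset.univ k m y := by
  set y' : Fin N → A := fun i => if hi : i.1 < n then y ⟨i.1, hi⟩ else 0 with hy'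
  have hsub : Finset.univ.map (Fin.castLEEmb hn) ⊆ Finset.univ := Finset.subset_univ _
  have h0 : ∀ i ∈ Finset.univ, i ∉ Finset.univ.map (Fin.castLEEmb hn) → y' i = 0 := by
    intro i _ hi
    rw [hy']
    refine dif_neg fun hin => hi ?_
    exact Finset.mem_map.2 ⟨⟨i.1, hin⟩, Finset.mem_univ _, rfl⟩
  have hyy : (fun i => y' (Fin.castLEEmb hn i)) = y := by
    funext i; simp [hy']
  have h1 : ∀ j, esymmAt Finset.univ j y' = esymmAt Finset.univ j y := fun j => by
    rw [esymmAt_of_subset hsub h0, esymmAt_map, hyy]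
  have h2 : esymmSubsetProd Finset.univ k m y' = esymmSubsetProd Finset.univ k m y := by
    rw [esymmSubsetProd_of_subset hsub h0, esymmSubsetProd_map, hyy]
  rw [← h2]
  exact esymmSubsetProd_congr fun j hj => by rw [h j hj, h1]

end Universal

/-- The Adams operations attached to `l`, characterised by Newton's recursion. -/
structure IsAdams {R : Type*} [CommRing R] (l ψ : ℕ → R → R) : Prop where
  one : ∀ x : R, ψ 1 x = x
  newton : ∀ k, 2 ≤ k → ∀ x : R, ψ k x =
    (∑ i ∈ Finset.Ico 1 k, (-1 : R) ^ (i + 1) * (l i x * ψ (k - i) x)) +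
      (-1 : R) ^ (k + 1) * (k : R) * l k x

section Lambda

universe u

variable {R : Type u} [CommRing R] {l ψ : ℕ → R → R}

lemma IsAdams.map_eq_sum_pow (hψ : IsAdams l ψ) (hl : IsLambdaRing l) {A ι : Type*} [CommRing A]
    (φ : R →+* A) (s : Finset ι) (f : ι → A) (r : R) {k : ℕ} (hk : 1 ≤ k)
    (h : ∀ j, 1 ≤ j → j ≤ k → φ (l j r) = esymmAt s j f) :
    φ (ψ k r) = ∑ i ∈ s, f i ^ k := by
  induction k using Nat.strong_induction_on with
  | _ k ih =>
    rw [sum_pow_eq_newton s f hk]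
    rcases hk.eq_or_lt with rfl | hk2
    · rw [hψ.one, ← h 1 le_rfl le_rfl, hl.map_one]; simp
    · rw [hψ.newton k hk2]
      simp only [map_add, map_sum, map_mul, map_pow, map_neg, map_one, map_natCast]
      rw [h k hk le_rfl]
      congr 1
      refine Finset.sum_congr rfl fun i hi => ?_
      rw [Finset.mem_Ico] at hi
      rw [h i hi.1 hi.2.le, ih (k - i) (by omega) (by omega) fun j h1 h2 => h j h1 (by omega)]

lemma aeval_ringHom {A σ : Type*} [CommRing A] (φ : R →+* A) (x : σ → R) (P : MvPolynomial σ ℤ) :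
    φ (aeval x P) = aeval (fun i => φ (x i)) P :=
  comp_aeval_apply x φ.toIntAlgHom P

lemma IsLambdaRing.map_mul_eq (hl : IsLambdaRing l) {A : Type u} {ι κ : Type*} [CommRing A]
    [Nontrivial A] [Fintype ι] [Fintype κ] (φ : R →+* A) (x : ι → A) (y : κ → A) (r s : R) {k : ℕ}
    (hk : 1 ≤ k) (hx : ∀ j ≤ k, φ (l j r) = esymmAt Finset.univ j x)
    (hy : ∀ j ≤ k, φ (l j s) = esymmAt Finset.univ j y) :
    φ (l k (r * s)) = esymmAt Finset.univ k (fun p : ι × κ => x p.1 * y p.2) := by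
  obtain ⟨P, hP⟩ := exists_isPk k
  obtain ⟨B, _, _, χ, x', hχ, hx'⟩ := exists_esymmAt_eq k (fun j => φ (l j r))
    (by simp [hl.map_zero])
  obtain ⟨D, _, _, θ, y', hθ, hy'⟩ := exists_esymmAt_eq k (fun j => χ (φ (l j s)))
    (by simp [hl.map_zero])
  apply hχ
  apply hθ
  rw [hl.mul_eq k hk P hP, map_esymmAt, map_esymmAt, aeval_ringHom, aeval_ringHom, aeval_ringHom]
  have h1 := congrArg (aeval (R := ℤ) (Sum.elim (fun i => θ (x' i)) y')) hP
  rw [← AlgHom.comp_apply, comp_aeval] at h1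
  have h2 := map_esymmAt (aeval (R := ℤ) (Sum.elim (fun i => θ (x' i)) y')).toRingHom
    Finset.univ k (fun p : Fin k × Fin k =>
        (X (Sum.inl p.1) : MvPolynomial (Fin k ⊕ Fin k) ℤ) * X (Sum.inr p.2))
  have h3 : ∀ j ≤ k, θ (χ (φ (l j r))) = esymmAt Finset.univ j (fun i => θ (x' i)) := by
    intro j hj
    rw [hx' j hj, map_esymmAt]
  have h4 : esymmAt Finset.univ k (fun p : Fin k × Fin k => θ (x' p.1) * y' p.2) =
      esymmAt Finset.univ k (fun p : ι × κ => θ (χ (x p.1)) * θ (χ (y p.2))) := by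
    refine esymmAt_mul_congr (fun i => θ (x' i)) (fun i => θ (χ (x i))) y'
      (fun i => θ (χ (y i))) k ?_ ?_
    · intro j hj
      rw [← h3 j hj, hx j hj, map_esymmAt, map_esymmAt]
    · intro j hj
      rw [← hy' j hj, hy j hj, map_esymmAt, map_esymmAt]
  simp only [map_mul, ← h4]
  have h5 := h1.trans h2
  simp only [AlgHom.toRingHom_eq_coe, RingHom.coe_coe, map_mul, aeval_X, Sum.elim_inl,
    Sum.elim_inr] at h5
  rw [← h5]
  congr 2
  funext i
  rcases i with i | i
  · have h6 := map_esymmAt (aeval (R := ℤ) (Sum.elim (fun i => θ (x' i)) y')).toRingHom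
      Finset.univ (i.1 + 1) (fun j => X (Sum.inl j))
    simp only [AlgHom.toRingHom_eq_coe, RingHom.coe_coe, aeval_X, Sum.elim_inl] at h6
    simp only [Sum.elim_inl, h6, h3 (i.1 + 1) i.2]
  · have h6 := map_esymmAt (aeval (R := ℤ) (Sum.elim (fun i => θ (x' i)) y')).toRingHom
      Finset.univ (i.1 + 1) (fun j => X (Sum.inr j))
    simp only [AlgHom.toRingHom_eq_coe, RingHom.coe_coe, aeval_X, Sum.elim_inr] at h6
    simp only [Sum.elim_inr, h6, hy' (i.1 + 1) i.2]

lemma IsLambdaRing.map_comp_eq (hl : IsLambdaRing l) {A : Type u} [CommRing A] [Nontrivial A]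
    (φ : R →+* A) {N k m : ℕ} (z : Fin N → A) (r : R) (hk : 1 ≤ k) (hm : 1 ≤ m) (hN : k * m ≤ N)
    (hz : ∀ j ≤ k * m, φ (l j r) = esymmAt Finset.univ j z) :
    φ (l k (l m r)) = esymmSubsetProd Finset.univ k m z := by
  obtain ⟨B, _, _, χ, x, hχ, hx⟩ := exists_esymmAt_eq (k * m) (fun j => φ (l j r))
    (by simp [hl.map_zero])
  obtain ⟨Q, hQ⟩ := exists_aeval_esymmAt_eq_esymmSubsetProd (k * m) k m
  have hQ' : IsPkl k m Q := hQ
  apply hχ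
  rw [hl.comp_eq k m hk hm Q hQ', aeval_ringHom, aeval_ringHom, map_esymmSubsetProd,
    esymmSubsetProd_congr_of_le hN (y := x),
    ← aeval_esymmAt_eq_esymmSubsetProd hQ]
  · congr 2
    funext i
    exact hx _ i.2
  · intro j hj
    rw [← map_esymmAt, ← hz j hj, hx j hj]

lemma IsAdams.map_lambda (hψ : IsAdams l ψ) (hl : IsLambdaRing l) {A : Type u} [CommRing A]
    [Nontrivial A] (φ : R →+* A) {N k m : ℕ} (z : Fin N → A) (r : R) (hk : 1 ≤ k) (hm : 1 ≤ m)
    (hN : k * m ≤ N) (hz : ∀ j ≤ k * m, φ (l j r) = esymmAt Finset.univ j z) :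
    φ (ψ k (l m r)) = esymmAt Finset.univ m (fun i => z i ^ k) := by
  rw [hψ.map_eq_sum_pow hl φ (Finset.univ.powersetCard m) (fun t => ∏ i ∈ t, z i) _ hk]
  · simp only [esymmAt, Finset.prod_pow]
  · intro j h1 h2
    have h3 : j * m ≤ k * m := Nat.mul_le_mul_right _ h2
    exact hl.map_comp_eq φ z r h1 hm (h3.trans hN) fun i hi => hz i (hi.trans h3)

lemma IsAdams.map_add [Nontrivial R] (hψ : IsAdams l ψ) (hl : IsLambdaRing l) {k : ℕ}
    (hk : 1 ≤ k) (r s : R) : ψ k (r + s) = ψ k r + ψ k s := by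
  obtain ⟨A, _, _, φ, x, hφ, hx⟩ := exists_esymmAt_eq k (fun j => l j r) (hl.map_zero r)
  obtain ⟨B, _, _, χ, y, hχ, hy⟩ := exists_esymmAt_eq k (fun j => φ (l j s))
    (by simp [hl.map_zero])
  have hx' : ∀ j ≤ k, (χ.comp φ) (l j r) = esymmAt Finset.univ j (fun i => χ (x i)) := by
    intro j hj
    rw [← map_esymmAt, ← hx j hj, RingHom.comp_apply]
  have hinj : Function.Injective (χ.comp φ) := by
    rw [RingHom.coe_comp]
    exact hχ.comp hφ
  apply hinj
  rw [RingHom.map_add, hψ.map_eq_sum_pow hl (χ.comp φ) Finset.univ _ r hk fun j _ => hx' j,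
    hψ.map_eq_sum_pow hl (χ.comp φ) Finset.univ y s hk fun j _ => hy j,
    hψ.map_eq_sum_pow hl (χ.comp φ) Finset.univ (Sum.elim (fun i => χ (x i)) y) _ hk,
    Fintype.sum_sum_type]
  · simp
  · intro j _ hj
    rw [hl.add_eq, esymmAt_sumElim, map_sum]
    refine Finset.sum_congr rfl fun i hi => ?_
    rw [Finset.mem_range] at hi
    rw [RingHom.map_mul, hx' i (by omega), RingHom.comp_apply, hy _ (by omega)]

lemma IsAdams.map_mul [Nontrivial R] (hψ : IsAdams l ψ) (hl : IsLambdaRing l) {k : ℕ}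
    (hk : 1 ≤ k) (r s : R) : ψ k (r * s) = ψ k r * ψ k s := by
  obtain ⟨A, _, _, φ, x, hφ, hx⟩ := exists_esymmAt_eq k (fun j => l j r) (hl.map_zero r)
  obtain ⟨B, _, _, χ, y, hχ, hy⟩ := exists_esymmAt_eq k (fun j => φ (l j s))
    (by simp [hl.map_zero])
  have hx' : ∀ j ≤ k, (χ.comp φ) (l j r) = esymmAt Finset.univ j (fun i => χ (x i)) := by
    intro j hj
    rw [← map_esymmAt, ← hx j hj, RingHom.comp_apply]
  have hinj : Function.Injective (χ.comp φ) := by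
    rw [RingHom.coe_comp]
    exact hχ.comp hφ
  apply hinj
  rw [RingHom.map_mul, hψ.map_eq_sum_pow hl (χ.comp φ) Finset.univ _ r hk fun j _ => hx' j,
    hψ.map_eq_sum_pow hl (χ.comp φ) Finset.univ y s hk fun j _ => hy j,
    hψ.map_eq_sum_pow hl (χ.comp φ) Finset.univ
      (fun p : Fin k × Fin k => χ (x p.1) * y p.2) _ hk,
    Finset.sum_mul_sum, Fintype.sum_prod_type]
  · simp only [mul_pow]
  · intro j h1 hj
    exact hl.map_mul_eq (χ.comp φ) (fun i => χ (x i)) y r s h1 (fun i hi => hx' i (hi.trans hj))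
      fun i hi => hy i (hi.trans hj)

lemma IsAdams.map_one (hψ : IsAdams l ψ) (hl : IsLambdaRing l) {k : ℕ}
    (hk : 1 ≤ k) : ψ k 1 = 1 := by
  have := hψ.map_eq_sum_pow hl (RingHom.id R) (Finset.univ : Finset Unit) (fun _ => 1) 1 hk ?_
  · simpa using this
  · intro j h1 _
    rw [← coeff_prod_one_add_C_mul_X, RingHom.id_apply]
    rcases h1.eq_or_lt with rfl | h2
    · simp [hl.map_one, Polynomial.coeff_one]
    · rw [hl.one_eq j h2]
      simp [Polynomial.coeff_one, Polynomial.coeff_X]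
      rw [if_neg (by omega), if_neg (by omega), add_zero]

/-- The Adams operation `ψ k` as a ring endomorphism. -/
def IsAdams.ringHom [Nontrivial R] (hψ : IsAdams l ψ) (hl : IsLambdaRing l) {k : ℕ}
    (hk : 1 ≤ k) : R →+* R where
  toFun := ψ k
  map_one' := hψ.map_one hl hk
  map_mul' := hψ.map_mul hl hk
  map_zero' := by simpa using hψ.map_add hl hk 0 0
  map_add' := hψ.map_add hl hk

/-- The generating series of the `λ`-operations. -/
def lambdaSeries (l : ℕ → R → R) (r : R) : PowerSeries R := PowerSeries.mk fun n => l n r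

lemma IsLambdaRing.lambdaSeries_add (hl : IsLambdaRing l) (r s : R) :
    lambdaSeries l (r + s) = lambdaSeries l r * lambdaSeries l s := by
  ext n
  rw [PowerSeries.coeff_mul, Finset.Nat.sum_antidiagonal_eq_sum_range_succ_mk]
  simp [lambdaSeries, hl.add_eq]

lemma IsLambdaRing.lambdaSeries_one (hl : IsLambdaRing l) :
    lambdaSeries l (1 : R) = 1 + PowerSeries.X := by
  ext n
  rcases n with _ | _ | n
  · simp [lambdaSeries, hl.map_zero]
  · simp [lambdaSeries, hl.map_one, PowerSeries.coeff_one]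
  · simp [lambdaSeries, hl.one_eq (n + 1 + 1) (by omega), PowerSeries.coeff_one,
      PowerSeries.coeff_X]

lemma IsLambdaRing.lambdaSeries_add_natCast (hl : IsLambdaRing l) (r : R) (n : ℕ) :
    lambdaSeries l (r + n) = lambdaSeries l r * (1 + PowerSeries.X) ^ n := by
  induction n with
  | zero => simp
  | succ n ih =>
    rw [Nat.cast_succ, ← add_assoc, hl.lambdaSeries_add, ih, hl.lambdaSeries_one, pow_succ,
      mul_assoc]

lemma IsLambdaRing.gammaOp_eq (hl : IsLambdaRing l) (x : R) {j N : ℕ} (hj : 1 ≤ j) (hN : j ≤ N) :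
    gammaOp l j x = ∑ i ∈ Finset.range (j + 1),
      (((-1) ^ (j - i) * ((N - i).choose (j - i) : ℤ) : ℤ) : R) * l i (x + N) := by
  set V : PowerSeries R := PowerSeries.rescale (-1)
    (PowerSeries.mk fun n => ((N - j + n).choose (N - j) : R)) with hV
  have hV1 : (1 + PowerSeries.X) ^ (N - j + 1) * V = 1 := by
    have := congrArg (PowerSeries.rescale (-1 : R))
      (PowerSeries.mk_add_choose_mul_one_sub_pow_eq_one R (N - j))
    rw [_root_.map_mul, map_pow, map_sub, _root_.map_one, PowerSeries.rescale_neg_one_X,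
      sub_neg_eq_add, mul_comm] at this
    exact this
  have h1 : lambdaSeries l (x + N) =
      lambdaSeries l (x + ((j - 1 : ℕ) : R)) * (1 + PowerSeries.X) ^ (N - j + 1) := by
    rw [← hl.lambdaSeries_add_natCast, add_assoc, ← Nat.cast_add]
    congr 3
    omega
  have h2 : lambdaSeries l (x + ((j - 1 : ℕ) : R)) = lambdaSeries l (x + N) * V := by
    rw [h1, mul_assoc, hV1, mul_one]
  have h3 := congrArg (PowerSeries.coeff j) h2
  rw [PowerSeries.coeff_mul, Finset.Nat.sum_antidiagonal_eq_sum_range_succ_mk] at h3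
  simp only [lambdaSeries, PowerSeries.coeff_mk, hV, PowerSeries.coeff_rescale] at h3
  rw [gammaOp, h3]
  refine Finset.sum_congr rfl fun i hi => ?_
  rw [Finset.mem_range] at hi
  rw [show N - j + (j - i) = N - i by omega,
    Nat.choose_symm_of_eq_add (show N - i = N - j + (j - i) by omega)]
  push_cast
  ring

end Lambda

section Filtration

universe u

variable {R : Type u} [CommRing R] {l ψ : ℕ → R → R} {ε : R →+* ℤ}

lemma gammaFil_succ_le (n : ℕ) : gammaFil l ε (n + 1) ≤ gammaFil l ε n := by
  rcases n with _ | n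
  · exact le_top
  · refine AddSubgroup.closure_mono ?_
    rintro x ⟨p, is, a, h1, h2, h3, h4⟩
    exact ⟨p, is, a, h1, h2, by omega, h4⟩

lemma gammaFil_antitone : Antitone (gammaFil l ε) := antitone_nat_of_succ_le gammaFil_succ_le

lemma prod_gammaOp_mem {p : ℕ} {is : Fin (p + 1) → ℕ} {a : Fin (p + 1) → R}
    (h1 : ∀ j, 1 ≤ is j) (h2 : ∀ j, ε (a j) = 0) :
    ∏ j, gammaOp l (is j) (a j) ∈ gammaFil l ε (∑ j, is j) := by
  obtain ⟨m, hm⟩ : ∃ m, ∑ j, is j = m + 1 := by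
    refine Nat.exists_eq_succ_of_ne_zero fun h => ?_
    have := h1 0
    have := Finset.sum_eq_zero_iff.1 h 0 (Finset.mem_univ _)
    omega
  rw [hm]
  exact AddSubgroup.subset_closure ⟨p, is, a, h1, h2, hm.ge, rfl⟩

lemma gammaOp_mem {i : ℕ} (hi : 1 ≤ i) {a : R} (ha : ε a = 0) :
    gammaOp l i a ∈ gammaFil l ε i := by
  simpa using prod_gammaOp_mem (l := l) (ε := ε) (p := 0) (is := fun _ => i) (a := fun _ => a)
    (fun _ => hi) (fun _ => ha)

lemma mul_mem_gammaFil_of_pos {m n : ℕ} (hm : 1 ≤ m) (hn : 1 ≤ n) {x y : R}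
    (hx : x ∈ gammaFil l ε m) (hy : y ∈ gammaFil l ε n) : x * y ∈ gammaFil l ε (m + n) := by
  obtain ⟨m, rfl⟩ := Nat.exists_eq_succ_of_ne_zero (Nat.ne_of_gt hm)
  obtain ⟨n, rfl⟩ := Nat.exists_eq_succ_of_ne_zero (Nat.ne_of_gt hn)
  change x ∈ AddSubgroup.closure _ at hx
  change y ∈ AddSubgroup.closure _ at hy
  induction hx using AddSubgroup.closure_induction with
  | mem x hx =>
    induction hy using AddSubgroup.closure_induction with
    | mem y hy =>
      obtain ⟨p, is, a, h1, h2, h3, rfl⟩ := hx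
      obtain ⟨q, js, b, h1', h2', h3', rfl⟩ := hy
      refine AddSubgroup.subset_closure
        ⟨p + 1 + q, Fin.append (m := p + 1) (n := q + 1) is js,
          Fin.append (m := p + 1) (n := q + 1) a b, ?_, ?_, ?_, ?_⟩
      · exact fun j => Fin.addCases (motive := fun j => 1 ≤ Fin.append is js j)
          (fun i => by simpa using h1 i) (fun i => by simpa using h1' i) j
      · exact fun j => Fin.addCases (motive := fun j => ε (Fin.append a b j) = 0)
          (fun i => by simpa using h2 i) (fun i => by simpa using h2' i) j
      · have := Fin.sum_univ_add (Fin.append is js)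
        simp only [Fin.append_left, Fin.append_right] at this
        change _ ≤ ∑ j : Fin (p + 1 + (q + 1)), Fin.append is js j
        rw [this]
        exact (add_le_add h3 h3').trans' (by simp only [Nat.succ_eq_add_one, Nat.add_eq]; omega)
      · have := Fin.prod_univ_add (fun j => gammaOp l (Fin.append is js j) (Fin.append a b j))
        simp only [Fin.append_left, Fin.append_right] at this
        exact this.symm
    | zero => rw [mul_zero]; exact zero_mem _
    | add y z _ _ h1 h2 => rw [mul_add]; exact add_mem h1 h2
    | neg y _ h => rw [mul_neg]; exact neg_mem h
  | zero => rw [zero_mul]; exact zero_mem _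
  | add x z _ _ h1 h2 => rw [add_mul]; exact add_mem h1 h2
  | neg x _ h => rw [neg_mul]; exact neg_mem h

lemma IsLambdaRing.mem_gammaFil_one (hl : IsLambdaRing l) {x : R} (hx : ε x = 0) :
    x ∈ gammaFil l ε 1 := by
  have := gammaOp_mem (l := l) le_rfl hx
  simpa [gammaOp, hl.map_one] using this

lemma intCast_mul_mem_gammaFil {n : ℕ} (c : ℤ) {x : R} (hx : x ∈ gammaFil l ε n) :
    (c : R) * x ∈ gammaFil l ε n := by
  rw [← zsmul_eq_mul]
  exact zsmul_mem hx c

lemma IsLambdaRing.mul_mem_gammaFil_left (hl : IsLambdaRing l) {n : ℕ} (y : R) {x : R}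
    (hx : x ∈ gammaFil l ε n) : y * x ∈ gammaFil l ε n := by
  rcases n.eq_zero_or_pos with rfl | hn
  · exact AddSubgroup.mem_top _
  · have h1 : y - (ε y : R) ∈ gammaFil l ε 1 := hl.mem_gammaFil_one (by simp)
    have h2 := gammaFil_antitone (Nat.le_add_left n 1) (mul_mem_gammaFil_of_pos le_rfl hn h1 hx)
    have h3 := add_mem h2 (intCast_mul_mem_gammaFil (ε y) hx)
    rwa [← add_mul, sub_add_cancel] at h3

lemma IsLambdaRing.mul_mem_gammaFil (hl : IsLambdaRing l) {m n : ℕ} {x y : R}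
    (hx : x ∈ gammaFil l ε m) (hy : y ∈ gammaFil l ε n) : x * y ∈ gammaFil l ε (m + n) := by
  rcases m.eq_zero_or_pos with rfl | hm
  · rw [zero_add]; exact hl.mul_mem_gammaFil_left x hy
  rcases n.eq_zero_or_pos with rfl | hn
  · rw [mul_comm]; exact hl.mul_mem_gammaFil_left y hx
  exact mul_mem_gammaFil_of_pos hm hn hx hy

/-- Isobaric polynomials in the `γ`-operations have coefficients in the `γ`-filtration. -/
lemma IsLambdaRing.coeff_aeval_gammaOp_mem (hl : IsLambdaRing l) {N : ℕ} {x : R} (hx : ε x = 0)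
    (Q : MvPolynomial (Fin N) ℤ) (d : ℕ) :
    (aeval (fun i : Fin N => Polynomial.X ^ (i.1 + 1) *
      Polynomial.C (gammaOp l (i.1 + 1) x)) Q).coeff d ∈ gammaFil l ε d := by
  induction Q using MvPolynomial.induction_on generalizing d with
  | C a =>
    rcases d with _ | d
    · exact AddSubgroup.mem_top _
    · have : ((algebraMap ℤ (Polynomial R)) a).coeff (d + 1) = 0 := by
        rw [eq_intCast, ← Polynomial.C_eq_intCast, Polynomial.coeff_C_succ]
      rw [aeval_C, this]
      exact zero_mem _
  | add p q hp hq => rw [map_add, Polynomial.coeff_add]; exact add_mem (hp d) (hq d)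
  | mul_X p i hp =>
    rw [_root_.map_mul, aeval_X, mul_comm, mul_assoc, Polynomial.coeff_X_pow_mul']
    split_ifs with h
    · rw [Polynomial.coeff_C_mul]
      have := hl.mul_mem_gammaFil (gammaOp_mem (l := l) (Nat.le_add_left 1 i.1) hx)
        (hp (d - (i.1 + 1)))
      rwa [Nat.add_sub_cancel' h] at this
    · exact zero_mem _

lemma exists_aeval_esymmAt_one_add_pow_sub_one (N m k : ℕ) :
    ∃ Q : MvPolynomial (Fin N) ℤ, ∀ {B : Type u} [CommRing B] (w : Fin N → B),
      aeval (fun i : Fin N => esymmAt Finset.univ (i.1 + 1) w) Q =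
        esymmAt Finset.univ m (fun a => (1 + w a) ^ k - 1) := by
  have hs : (esymmAt Finset.univ m
      (fun a => (1 + (X a : MvPolynomial (Fin N) ℤ)) ^ k - 1)).IsSymmetric := by
    intro e
    have h1 := map_esymmAt (rename e : MvPolynomial (Fin N) ℤ →ₐ[ℤ] _).toRingHom
      Finset.univ m (fun a => (1 + X a) ^ k - 1)
    have h2 := esymmAt_map e.toEmbedding Finset.univ
      (fun a => (1 + (X a : MvPolynomial (Fin N) ℤ)) ^ k - 1) m
    rw [Finset.map_univ_equiv] at h2
    refine Eq.trans ?_ h2.symm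
    simpa using h1
  obtain ⟨Q, hQ⟩ := exists_aeval_esymmAt_of_isSymmetric hs
  refine ⟨Q, fun {B} _ w => ?_⟩
  rw [aeval_esymmAt_of_eq hQ]
  have h1 := map_esymmAt (aeval w : MvPolynomial (Fin N) ℤ →ₐ[ℤ] B).toRingHom
    Finset.univ m (fun a => (1 + X a) ^ k - 1)
  simpa using h1

/-- The leading term of the elementary symmetric functions of `(1 + w)^k - 1`. -/
lemma coeff_esymmAt_one_add_pow_sub_one {A ι : Type*} [CommRing A] (s : Finset ι) (w : ι → A)
    (m k d : ℕ) (hd : d ≤ m) :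
    (esymmAt s m (fun a => (1 + Polynomial.X * Polynomial.C (w a)) ^ k - 1)).coeff d =
      if d = m then (k : A) ^ m * esymmAt s m w else 0 := by
  have h : (fun a => (1 + Polynomial.X * Polynomial.C (w a)) ^ k - 1) = fun a =>
      Polynomial.X * (Polynomial.C (w a) *
        ∑ i ∈ Finset.range k, (1 + Polynomial.X * Polynomial.C (w a)) ^ i) := by
    funext a
    rw [← mul_geom_sum]
    ring
  rw [h, esymmAt_smul, Polynomial.coeff_X_pow_mul']
  rcases hd.lt_or_eq with hlt | rfl
  · rw [if_neg (by omega), if_neg (by omega)]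
  · rw [if_pos le_rfl, if_pos rfl, Nat.sub_self, ← Polynomial.constantCoeff_apply, map_esymmAt,
      ← esymmAt_smul]
    refine esymmAt_congr (fun a _ => ?_) d
    rw [_root_.map_mul, map_sum]
    simp only [map_pow, map_add, _root_.map_mul, _root_.map_one, Polynomial.constantCoeff_apply,
      Polynomial.coeff_X_zero, Polynomial.coeff_C_zero]
    simp [mul_comm]

lemma IsAdams.gammaOp_sub_mem [Nontrivial R] (hψ : IsAdams l ψ) (hl : IsLambdaRing l) {m k : ℕ}
    (hm : 1 ≤ m) (hk : 1 ≤ k) {x : R} (hx : ε x = 0) :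
    ψ k (gammaOp l m x) - (k : R) ^ m * gammaOp l m x ∈ gammaFil l ε (m + 1) := by
  obtain ⟨A, _, _, φ, z, hφ, hz⟩ := exists_esymmAt_eq (k * m)
    (fun j => l j (x + ((k * m : ℕ) : R))) (hl.map_zero _)
  have hmN : m ≤ k * m := Nat.le_mul_of_pos_left m hk
  have hcard : (Finset.univ : Finset (Fin (k * m))).card = k * m := by simp
  set w : Fin (k * m) → A := fun a => z a - 1 with hw
  have hγ : ∀ j, 1 ≤ j → j ≤ k * m → φ (gammaOp l j x) = esymmAt Finset.univ j w := by
    intro j h1 h2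
    rw [hl.gammaOp_eq x h1 h2, hw, esymmAt_sub_one _ _ (by rwa [hcard]), hcard, map_sum]
    refine Finset.sum_congr rfl fun i hi => ?_
    rw [Finset.mem_range] at hi
    rw [_root_.map_mul, map_intCast, hz i (by omega)]
  have hψγ : φ (ψ k (gammaOp l m x)) =
      esymmAt Finset.univ m (fun a => (1 + w a) ^ k - 1) := by
    have h1 : (fun a => (1 + w a) ^ k - 1) = fun a => z a ^ k - 1 := by
      funext a; simp [hw]
    rw [h1, esymmAt_sub_one _ _ (by rwa [hcard]), hcard, hl.gammaOp_eq x hm hmN]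
    change φ (hψ.ringHom hl hk _) = _
    rw [map_sum, map_sum]
    refine Finset.sum_congr rfl fun i hi => ?_
    rw [Finset.mem_range] at hi
    rw [_root_.map_mul, _root_.map_mul, map_intCast, map_intCast]
    congr 1
    change φ (ψ k _) = _
    rcases i.eq_zero_or_pos with rfl | hi0
    · rw [hl.map_zero, hψ.map_one hl hk, esymmAt_zero, _root_.map_one]
    · have : k * i ≤ k * m := Nat.mul_le_mul_left k (by omega)
      exact hψ.map_lambda hl φ z _ hk hi0 this fun j hj => hz j (hj.trans this)
  obtain ⟨Q, hQ⟩ := exists_aeval_esymmAt_one_add_pow_sub_one.{u} (k * m) m k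
  set g : Polynomial R := aeval (fun i : Fin (k * m) => Polynomial.X ^ (i.1 + 1) *
      Polynomial.C (gammaOp l (i.1 + 1) x)) Q with hg
  have hgmap : g.map φ = esymmAt Finset.univ m
      (fun a => (1 + Polynomial.X * Polynomial.C (w a)) ^ k - 1) := by
    rw [← hQ, ← Polynomial.coe_mapRingHom, hg]
    refine (aeval_ringHom (Polynomial.mapRingHom φ) _ Q).trans ?_
    congr 2
    funext i
    rw [esymmAt_smul, ← map_esymmAt, ← hγ _ (by omega) i.2]
    simp
  have hg1 : g.eval 1 = ψ k (gammaOp l m x) := by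
    apply hφ
    rw [hψγ, ← Polynomial.eval_map_apply, hgmap, _root_.map_one, ← Polynomial.coe_evalRingHom,
      map_esymmAt]
    simp
  have hcoeff : ∀ d ≤ m, g.coeff d = if d = m then (k : R) ^ m * gammaOp l m x else 0 := by
    intro d hd
    apply hφ
    rw [← Polynomial.coeff_map, hgmap, coeff_esymmAt_one_add_pow_sub_one _ _ _ _ _ hd]
    split_ifs
    · rw [_root_.map_mul, map_pow, map_natCast, hγ m hm hmN]
    · rw [_root_.map_zero]
  have hdecomp : ψ k (gammaOp l m x) - (k : R) ^ m * gammaOp l m x =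
      ∑ d ∈ Finset.range (g.natDegree + 1 + (m + 1)), if d ≤ m then 0 else g.coeff d := by
    have h1 := hcoeff m le_rfl
    rw [if_pos rfl] at h1
    have hmem : m ∈ Finset.range (g.natDegree + 1 + (m + 1)) := Finset.mem_range.2 (by omega)
    rw [← hg1, Polynomial.eval_eq_sum_range' (n := g.natDegree + 1 + (m + 1)) (by omega), ← h1,
      sub_eq_iff_eq_add, ← Finset.sum_erase_add _ _ hmem,
      ← Finset.sum_erase_add _ (fun d => if d ≤ m then 0 else g.coeff d) hmem]
    simp only [one_pow, mul_one, le_refl, if_true, add_zero]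
    congr 1
    refine Finset.sum_congr rfl fun d hd => ?_
    split_ifs with h
    · rw [hcoeff d h, if_neg (Finset.ne_of_mem_erase hd)]
    · rfl
  rw [hdecomp]
  refine sum_mem fun d _ => ?_
  split_ifs with h
  · exact zero_mem _
  · exact gammaFil_antitone (by omega : m + 1 ≤ d) (hl.coeff_aeval_gammaOp_mem hx Q d)

lemma IsAdams.prod_gammaOp_sub_mem [Nontrivial R] (hψ : IsAdams l ψ) (hl : IsLambdaRing l) {k : ℕ}
    (hk : 1 ≤ k) {p : ℕ} {is : Fin (p + 1) → ℕ} {a : Fin (p + 1) → R}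
    (h1 : ∀ j, 1 ≤ is j) (h2 : ∀ j, ε (a j) = 0) :
    ψ k (∏ j, gammaOp l (is j) (a j)) - (k : R) ^ (∑ j, is j) * ∏ j, gammaOp l (is j) (a j) ∈
      gammaFil l ε (∑ j, is j + 1) := by
  induction p with
  | zero => simpa using hψ.gammaOp_sub_mem hl (h1 0) hk (h2 0)
  | succ p ih =>
    have hI := ih (fun j => h1 j.castSucc) (fun j => h2 j.castSucc)
    have hP := prod_gammaOp_mem (l := l) (ε := ε) (fun j => h1 j.castSucc) (fun j => h2 j.castSucc)
    have hL := hψ.gammaOp_sub_mem hl (h1 (Fin.last _)) hk (h2 (Fin.last _))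
    have hG := gammaOp_mem (l := l) (h1 (Fin.last _)) (h2 (Fin.last _))
    rw [Fin.prod_univ_castSucc, Fin.sum_univ_castSucc, hψ.map_mul hl hk]
    generalize (∏ j : Fin (p + 1), gammaOp l (is j.castSucc) (a j.castSucc)) = y at *
    generalize (∑ j : Fin (p + 1), is j.castSucc) = s at *
    generalize gammaOp l (is (Fin.last (p + 1))) (a (Fin.last (p + 1))) = z at *
    generalize is (Fin.last (p + 1)) = t at *
    have hz : ψ k z ∈ gammaFil l ε t := by
      have h3 := add_mem (gammaFil_succ_le _ hL) (intCast_mul_mem_gammaFil ((k : ℤ) ^ t) hG)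
      push_cast at h3
      rwa [sub_add_cancel] at h3
    have e1 := hl.mul_mem_gammaFil hI hz
    have e2 := intCast_mul_mem_gammaFil ((k : ℤ) ^ s) (hl.mul_mem_gammaFil hP hL)
    rw [show s + 1 + t = s + t + 1 by ring] at e1
    rw [← add_assoc] at e2
    have e3 := add_mem e1 e2
    push_cast at e3
    convert e3 using 1
    ring

lemma IsAdams.map_augmentation [Nontrivial R] (hψ : IsAdams l ψ) (hl : IsLambdaRing l)
    (hε : ∀ (n : ℕ) (r : R), ε (l n r) = Ring.choose (ε r) n) {k : ℕ} (hk : 1 ≤ k) (x : R) :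
    ε (ψ k x) = ε x := by
  have h0 : ∀ k, 1 ≤ k → ∀ x, ε x = 0 → ε (ψ k x) = 0 := by
    intro k hk x hx
    have hz : ∀ i, 1 ≤ i → ε (l i x) = 0 := by
      intro i hi
      rw [hε, hx, Ring.choose_zero_pos]
      omega
    rcases hk.eq_or_lt with rfl | hk2
    · rw [hψ.one, hx]
    · rw [hψ.newton k hk2, _root_.map_add, map_sum, _root_.map_mul, hz k hk, mul_zero, add_zero]
      refine Finset.sum_eq_zero fun i hi => ?_
      rw [_root_.map_mul, _root_.map_mul, hz i (Finset.mem_Ico.1 hi).1, zero_mul, mul_zero]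
  have h1 := h0 k hk (x - (ε x : R)) (by simp)
  change ε (hψ.ringHom hl hk _) = 0 at h1
  rw [map_sub, map_intCast, map_sub, map_intCast, sub_eq_zero] at h1
  exact h1

end Filtration

/-- for a λ-ring `R` with augmentation `ε : R → ℤ` commuting with the
λ-operations, the Adams operation `ψ^k` acts on `F^n R` as multiplication by `k^n` modulo
`F^{n+1} R`: for `x ∈ F^n R`, `ψ^k(x) − k^n·x ∈ F^{n+1} R`. -/
theorem stmt_8 {R : Type*} [CommRing R] (l : ℕ → R → R) (hl : IsLambdaRing l)
    (ε : R →+* ℤ) (hε : ∀ (n : ℕ) (r : R), ε (l n r) = Ring.choose (ε r) n)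
    (ψ : ℕ → R → R)
    (hψ1 : ∀ x : R, ψ 1 x = x)
    (hψrec : ∀ k, 2 ≤ k → ∀ x : R, ψ k x =
      (∑ i ∈ Finset.Ico 1 k, (-1 : R) ^ (i + 1) * (l i x * ψ (k - i) x)) +
        (-1 : R) ^ (k + 1) * (k : R) * l k x) :
    ∀ (n k : ℕ), 1 ≤ k → ∀ x : R, x ∈ gammaFil l ε n →
      ψ k x - (k : R) ^ n * x ∈ gammaFil l ε (n + 1) := by
  intro n k hk x hx
  have : Nontrivial R := ε.domain_nontrivial
  have hψ : IsAdams l ψ := ⟨hψ1, hψrec⟩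
  rcases n with _ | n
  · refine hl.mem_gammaFil_one ?_
    rw [map_sub, hψ.map_augmentation hl hε hk, pow_zero, one_mul, sub_self]
  · set θ := hψ.ringHom hl hk
    change θ x - _ ∈ _
    change x ∈ AddSubgroup.closure _ at hx
    induction hx using AddSubgroup.closure_induction with
    | mem x hx =>
      obtain ⟨p, is, a, h1, h2, h3, rfl⟩ := hx
      rcases h3.eq_or_lt with h4 | h4
      · rw [h4]
        exact hψ.prod_gammaOp_sub_mem hl hk h1 h2
      · have e1 := gammaFil_succ_le _ (hψ.prod_gammaOp_sub_mem hl hk h1 h2)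
        have hP := prod_gammaOp_mem (l := l) h1 h2
        have e2 := intCast_mul_mem_gammaFil ((k : ℤ) ^ (∑ j, is j) - (k : ℤ) ^ (n + 1)) hP
        have e3 := gammaFil_antitone h4 (add_mem e1 e2)
        push_cast at e3
        convert e3 using 1
        rw [sub_mul, sub_add_sub_cancel]
        rfl
    | zero => simp
    | add x y _ _ hx hy =>
      have := add_mem hx hy
      rwa [sub_add_sub_comm, ← map_add, ← mul_add] at this
    | neg x _ hx =>
      have := neg_mem hx
      rwa [neg_sub', ← map_neg, ← mul_neg] at this
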